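/- Let λ > 0 and let (ν_n)_{n≥1} satisfy 0 < ν_n ≤ 1 for all n. For n ≥ 1 and t ≥ 0 define p_*(n,t) = ((−1)^{n−1}/n) ∑_{k=n−1}^∞ (−λ)^k ∑_{(k_1,…,k_n) ∈ Λ^k_n} ( t^{∑_{j=1}^n k_j ν_j} ∏_{j=1}^n j^{k_j} ) / Γ(1 + ∑_{j=1}^n k_j ν_j), and set p_*(0,t) = 0. Then for every n ≥ 1 and every t ≥ 0, p_*(n,t) = [n=1] + (I^{ν_n}_t ( −λ n · p_*(n,·) + λ (n−1) · p_*(n−1,·) ))(t), where [n=1] equals 1 if n = 1 and 0 otherwise; that is, p_* is the probability mass function of the state dependent linear birth process obtained from SDFPBP with λ_n = λ n. -/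

import Mathlib

open scoped BigOperators

/-- Riemann–Liouville fractional integral of order `α`. -/
noncomputable def rlInt (α : ℝ) (f : ℝ → ℝ) (t : ℝ) : ℝ :=
  (1 / Real.Gamma α) * ∫ s in (0:ℝ)..t, (t - s) ^ (α - 1) * f s

/-- `Lambda n k` is the set of tuples `(k_1, …, k_n)` of nonnegative integers with
`k_1 + ⋯ + k_n = k` and `k_j ≥ 1` for `2 ≤ j ≤ n` (`k_1` may be `0`); the coordinate
`j : Fin n` represents the index `j + 1 ∈ {1, …, n}`. -/
def Lambda (n k : ℕ) : Finset (Fin n → ℕ) :=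
  (Finset.Nat.antidiagonalTuple n k).filter
    (fun κ => ∀ j : Fin n, 1 ≤ j.val → 1 ≤ κ j)

/-- The state probabilities of the state dependent fractional pure birth process
(note that `Lambda n k = ∅` for `k < n - 1`, so the series over all `k : ℕ` agrees
with the series starting at `k = n - 1`). -/
noncomputable def rBirth (lam : ℕ → ℝ) (ν : ℕ → ℝ) (n : ℕ) (t : ℝ) : ℝ :=
  (-1 : ℝ) ^ (n - 1) * (lam 1 / lam n) * ∑' k : ℕ, (-1 : ℝ) ^ k *
    ∑ κ ∈ Lambda n k,
      (t ^ (∑ j, (κ j : ℝ) * ν (j.val + 1)) * ∏ j, lam (j.val + 1) ^ (κ j)) /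
        Real.Gamma (1 + ∑ j, (κ j : ℝ) * ν (j.val + 1))

/-- The state probabilities of the state dependent linear birth process (SDLBP),
obtained from SDFPBP with birth rates `λ_n = λ n`. -/
noncomputable def pSDLBP (lam : ℝ) (ν : ℕ → ℝ) (n : ℕ) (t : ℝ) : ℝ :=
  ((-1 : ℝ) ^ (n - 1) / (n : ℝ)) * ∑' k : ℕ, (-lam) ^ k *
    ∑ κ ∈ Lambda n k,
      (t ^ (∑ j, (κ j : ℝ) * ν (j.val + 1)) * ∏ j, ((j.val + 1 : ℕ) : ℝ) ^ (κ j)) /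
        Real.Gamma (1 + ∑ j, (κ j : ℝ) * ν (j.val + 1))

open MeasureTheory

theorem intervalIntegrable_sub_rpow {α : ℝ} (hα : 0 < α) (t : ℝ) :
    IntervalIntegrable (fun s => (t - s) ^ (α - 1)) volume 0 t := by
  have h := (intervalIntegral.intervalIntegrable_rpow' (a := t) (b := 0)
    (show -1 < α - 1 by linarith)).comp_sub_left t
  simpa using h

theorem intervalIntegrable_sub_rpow_mul {α : ℝ} (hα : 0 < α) {f : ℝ → ℝ} (hf : Continuous f)
    (t : ℝ) : IntervalIntegrable (fun s => (t - s) ^ (α - 1) * f s) volume 0 t :=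
  (intervalIntegrable_sub_rpow hα t).mul_continuousOn hf.continuousOn

theorem rlInt_const_mul (α c : ℝ) (f : ℝ → ℝ) (t : ℝ) :
    rlInt α (fun s => c * f s) t = c * rlInt α f t := by
  simp only [rlInt, mul_left_comm _ c, intervalIntegral.integral_const_mul]

theorem rlInt_add {α : ℝ} (hα : 0 < α) {f g : ℝ → ℝ} (hf : Continuous f) (hg : Continuous g)
    (t : ℝ) : rlInt α (fun s => f s + g s) t = rlInt α f t + rlInt α g t := by
  simp only [rlInt, mul_add]
  rw [intervalIntegral.integral_add (intervalIntegrable_sub_rpow_mul hα hf t)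
    (intervalIntegrable_sub_rpow_mul hα hg t), mul_add]

theorem rlInt_finset_sum {α : ℝ} (hα : 0 < α) {ι : Type*} (s : Finset ι) {f : ι → ℝ → ℝ}
    (hf : ∀ i ∈ s, Continuous (f i)) (t : ℝ) :
    rlInt α (fun u => ∑ i ∈ s, f i u) t = ∑ i ∈ s, rlInt α (f i) t := by
  simp only [rlInt, Finset.mul_sum]
  rw [intervalIntegral.integral_finsetSum
    fun i hi => intervalIntegrable_sub_rpow_mul hα (hf i hi) t, Finset.mul_sum]

theorem rlInt_hasSum {α : ℝ} (hα : 0 < α) {f : ℕ → ℝ → ℝ} {b : ℕ → ℝ} {t : ℝ} {g : ℝ → ℝ}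
    (ht : 0 ≤ t) (hf : ∀ k, Continuous (f k)) (hb : Summable b)
    (hfb : ∀ k, ∀ s ∈ Set.Icc 0 t, |f k s| ≤ b k)
    (hg : ∀ s ∈ Set.Icc 0 t, HasSum (fun k => f k s) (g s)) :
    HasSum (fun k => rlInt α (f k) t) (rlInt α g t) := by
  have hmem : ∀ s ∈ Set.uIoc 0 t, s ∈ Set.Icc 0 t := fun s hs => by
    rw [Set.uIoc_of_le ht] at hs
    exact ⟨hs.1.le, hs.2⟩
  refine HasSum.mul_left _ (intervalIntegral.hasSum_integral_of_dominated_convergence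
    (fun k s => (t - s) ^ (α - 1) * b k) (fun k => ?_) (fun k => ?_) ?_ ?_ ?_)
  · exact (intervalIntegrable_sub_rpow_mul hα (hf k) t).def'.aestronglyMeasurable
  · refine ae_of_all _ fun s hs => ?_
    have h := hmem s hs
    have hp : 0 ≤ (t - s) ^ (α - 1) := Real.rpow_nonneg (sub_nonneg.2 h.2) _
    rw [Real.norm_eq_abs, abs_mul, abs_of_nonneg hp]
    exact mul_le_mul_of_nonneg_left (hfb k s h) hp
  · exact ae_of_all _ fun s _ => hb.mul_left _
  · simp only [tsum_mul_left]
    exact (intervalIntegrable_sub_rpow hα t).mul_const _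
  · exact ae_of_all _ fun s hs => (hg s (hmem s hs)).mul_left _

theorem integral_sub_rpow_mul_rpow {α e t : ℝ} (hα : 0 < α) (he : 0 ≤ e) (ht : 0 < t) :
    ∫ s in (0 : ℝ)..t, (t - s) ^ (α - 1) * s ^ e
      = t ^ (e + α) * (Real.Gamma (1 + e) * Real.Gamma α / Real.Gamma (1 + (e + α))) := by
  have h := Complex.betaIntegral_scaled ((1 + e : ℝ) : ℂ) (α : ℂ) ht
  rw [Complex.betaIntegral_eq_Gamma_mul_div _ _ (by simpa using by linarith) (by simpa)] at h
  have hint : ∫ x in (0 : ℝ)..t, (x : ℂ) ^ (((1 + e : ℝ) : ℂ) - 1) * ((t : ℂ) - x) ^ ((α : ℂ) - 1)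
      = ∫ x in (0 : ℝ)..t, (((t - x) ^ (α - 1) * x ^ e : ℝ) : ℂ) := by
    refine intervalIntegral.integral_congr fun x hx => ?_
    rw [Set.uIcc_of_le ht.le] at hx
    push_cast [Complex.ofReal_cpow hx.1, Complex.ofReal_cpow (sub_nonneg.2 hx.2)]
    ring_nf
  rw [hint, intervalIntegral.integral_ofReal, ← Complex.ofReal_add, Complex.Gamma_ofReal,
    Complex.Gamma_ofReal, Complex.Gamma_ofReal, ← Complex.ofReal_one, ← Complex.ofReal_sub,
    ← Complex.ofReal_cpow ht.le] at h
  have h' := Complex.ofReal_injective (by exact_mod_cast h)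
  rw [h']
  ring_nf

theorem rlInt_rpow_div_Gamma {α e t : ℝ} (hα : 0 < α) (he : 0 ≤ e) (ht : 0 ≤ t) :
    rlInt α (fun s => s ^ e / Real.Gamma (1 + e)) t = t ^ (e + α) / Real.Gamma (1 + (e + α)) := by
  rcases ht.eq_or_lt with rfl | ht
  · simp [rlInt, Real.zero_rpow (by linarith : e + α ≠ 0)]
  · have h1 : Real.Gamma (1 + e) ≠ 0 := (Real.Gamma_pos_of_pos (by linarith)).ne'
    have h2 : Real.Gamma α ≠ 0 := (Real.Gamma_pos_of_pos hα).ne'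
    simp only [rlInt, div_eq_mul_inv _ (Real.Gamma (1 + e)), ← mul_assoc,
      intervalIntegral.integral_mul_const]
    rw [integral_sub_rpow_mul_rpow hα he ht]
    field_simp

theorem rpow_mul_exp_neg_le_Gamma {M x : ℝ} (hM : 0 ≤ M) (hx : 0 ≤ x) :
    M ^ x * Real.exp (-(M + 1)) ≤ Real.Gamma (1 + x) := by
  have hsub : Set.Ioc M (M + 1) ⊆ Set.Ioi 0 := fun u hu => hM.trans_lt hu.1
  have hint := Real.GammaIntegral_convergent (show 0 < 1 + x by linarith)
  rw [Real.Gamma_eq_integral (by linarith)]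
  calc M ^ x * Real.exp (-(M + 1))
      = ∫ _u in Set.Ioc M (M + 1), M ^ x * Real.exp (-(M + 1)) := by simp
    _ ≤ ∫ u in Set.Ioc M (M + 1), Real.exp (-u) * u ^ (1 + x - 1) := by
        refine setIntegral_mono_on (integrableOn_const (by simp)) (hint.mono_set hsub)
          measurableSet_Ioc fun u hu => ?_
        rw [mul_comm, add_sub_cancel_left]
        gcongr
        · exact hu.2
        · exact hu.1.le
    _ ≤ _ := setIntegral_mono_set hint
        ((ae_restrict_mem measurableSet_Ioi).mono fun u hu =>
          mul_nonneg (Real.exp_nonneg _) (Real.rpow_nonneg (le_of_lt hu) _)) hsub.eventuallyLE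

/-- The contribution of the exponent tuple `κ` to the state probabilities of the SDLBP, without
the power of `-λ`. -/
noncomputable def birthTerm (ν : ℕ → ℝ) {n : ℕ} (κ : Fin n → ℕ) (t : ℝ) : ℝ :=
  (t ^ (∑ j, (κ j : ℝ) * ν (j.val + 1)) * ∏ j, ((j.val + 1 : ℕ) : ℝ) ^ (κ j)) /
    Real.Gamma (1 + ∑ j, (κ j : ℝ) * ν (j.val + 1))

/-- The coefficient of `(-λ) ^ k` in the series of the `n`-th state probability of the SDLBP. -/
noncomputable def birthCoeff (ν : ℕ → ℝ) (n k : ℕ) (t : ℝ) : ℝ :=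
  ∑ κ ∈ Lambda n k, birthTerm ν κ t

theorem pSDLBP_eq (lam : ℝ) (ν : ℕ → ℝ) (n : ℕ) (t : ℝ) :
    pSDLBP lam ν n t = ((-1 : ℝ) ^ (n - 1) / n) * ∑' k : ℕ, (-lam) ^ k * birthCoeff ν n k t :=
  rfl


theorem birthExponent_nonneg {ν : ℕ → ℝ} (hν : ∀ m, 1 ≤ m → 0 < ν m) {n : ℕ}
    (κ : Fin n → ℕ) : 0 ≤ ∑ j, (κ j : ℝ) * ν (j.val + 1) :=
  Finset.sum_nonneg fun j _ => mul_nonneg (Nat.cast_nonneg _) (hν _ (by omega)).le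

theorem continuous_birthTerm {ν : ℕ → ℝ} (hν : ∀ m, 1 ≤ m → 0 < ν m)
    {n : ℕ} (κ : Fin n → ℕ) : Continuous (birthTerm ν κ) :=
  ((Real.continuous_rpow_const (birthExponent_nonneg hν κ)).mul continuous_const).div_const _

theorem continuous_birthCoeff {ν : ℕ → ℝ} (hν : ∀ m, 1 ≤ m → 0 < ν m)
    (n k : ℕ) : Continuous (birthCoeff ν n k) :=
  continuous_finsetSum _ fun κ _ => continuous_birthTerm hν κ

theorem birthTerm_nonneg {ν : ℕ → ℝ} (hν : ∀ m, 1 ≤ m → 0 < ν m)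
    {n : ℕ} (κ : Fin n → ℕ) {t : ℝ} (ht : 0 ≤ t) :
    0 ≤ birthTerm ν κ t := by
  have := birthExponent_nonneg hν κ
  exact div_nonneg (mul_nonneg (Real.rpow_nonneg ht _) (by positivity))
    (Real.Gamma_pos_of_pos (by linarith)).le

theorem birthTerm_mono {ν : ℕ → ℝ} (hν : ∀ m, 1 ≤ m → 0 < ν m)
    {n : ℕ} (κ : Fin n → ℕ) {s t : ℝ} (hs : 0 ≤ s) (hst : s ≤ t) :
    birthTerm ν κ s ≤ birthTerm ν κ t := by
  have h := birthExponent_nonneg hν κ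
  have hG : 0 < Real.Gamma (1 + ∑ j, (κ j : ℝ) * ν (j.val + 1)) :=
    Real.Gamma_pos_of_pos (by linarith)
  unfold birthTerm
  gcongr

theorem birthCoeff_nonneg {ν : ℕ → ℝ} (hν : ∀ m, 1 ≤ m → 0 < ν m)
    (n k : ℕ) {t : ℝ} (ht : 0 ≤ t) : 0 ≤ birthCoeff ν n k t :=
  Finset.sum_nonneg fun κ _ => birthTerm_nonneg hν κ ht

theorem birthCoeff_mono {ν : ℕ → ℝ} (hν : ∀ m, 1 ≤ m → 0 < ν m)
    (n k : ℕ) {s t : ℝ} (hs : 0 ≤ s) (hst : s ≤ t) :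
    birthCoeff ν n k s ≤ birthCoeff ν n k t :=
  Finset.sum_le_sum fun κ _ => birthTerm_mono hν κ hs hst

theorem birthTerm_le {ν : ℕ → ℝ} (hν : ∀ m, 1 ≤ m → 0 < ν m)
    {n : ℕ} (κ : Fin n → ℕ) {t M : ℝ} (ht : 0 ≤ t) (hM : 0 < M) :
    birthTerm ν κ t ≤ Real.exp (M + 1) *
      ∏ j : Fin n, (((j.val + 1 : ℕ) : ℝ) * (t / M) ^ ν (j.val + 1)) ^ κ j := by
  have h := birthExponent_nonneg hν κ
  have hG : 0 < Real.Gamma (1 + ∑ j, (κ j : ℝ) * ν (j.val + 1)) :=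
    Real.Gamma_pos_of_pos (by linarith)
  have hlow := rpow_mul_exp_neg_le_Gamma hM.le h
  have hprod : ∏ j : Fin n, (((j.val + 1 : ℕ) : ℝ) * (t / M) ^ ν (j.val + 1)) ^ κ j
      = (∏ j : Fin n, ((j.val + 1 : ℕ) : ℝ) ^ κ j)
        * (t ^ (∑ j, (κ j : ℝ) * ν (j.val + 1)) / M ^ (∑ j, (κ j : ℝ) * ν (j.val + 1))) := by
    simp_rw [mul_pow]
    rw [Finset.prod_mul_distrib, ← Real.div_rpow ht hM.le,
      Real.rpow_sum_of_nonneg (div_nonneg ht hM.le)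
        fun j _ => mul_nonneg (Nat.cast_nonneg _) (hν _ (by omega)).le]
    congr 1
    refine Finset.prod_congr rfl fun j _ => ?_
    rw [mul_comm (κ j : ℝ), Real.rpow_mul (div_nonneg ht hM.le), Real.rpow_natCast]
  have hMe : 0 < M ^ (∑ j, (κ j : ℝ) * ν (j.val + 1)) := Real.rpow_pos_of_pos hM _
  rw [hprod, birthTerm, div_le_iff₀ hG]
  set P := ∏ j : Fin n, ((j.val + 1 : ℕ) : ℝ) ^ κ j
  have hP : 0 ≤ P := by positivity
  have ht' : 0 ≤ t ^ (∑ j, (κ j : ℝ) * ν (j.val + 1)) := Real.rpow_nonneg ht _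
  generalize t ^ (∑ j, (κ j : ℝ) * ν (j.val + 1)) = T at *
  generalize M ^ (∑ j, (κ j : ℝ) * ν (j.val + 1)) = R at *
  calc T * P = Real.exp (M + 1) * (P * (T / R)) * (R * Real.exp (-(M + 1))) := by
        rw [Real.exp_neg]
        field_simp
    _ ≤ _ := by gcongr

theorem exists_sum_birthRatio_lt_one {ν : ℕ → ℝ} (hν : ∀ m, 1 ≤ m → 0 < ν m) (n : ℕ) (lam t : ℝ) :
    ∃ M : ℝ, 0 < M ∧
      lam * ∑ j : Fin n, ((j.val + 1 : ℕ) : ℝ) * (t / M) ^ ν (j.val + 1) < 1 := by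
  have h : Filter.Tendsto
      (fun M : ℝ => lam * ∑ j : Fin n, ((j.val + 1 : ℕ) : ℝ) * (t / M) ^ ν (j.val + 1))
      Filter.atTop (nhds (lam * ∑ j : Fin n, ((j.val + 1 : ℕ) : ℝ) * 0)) := by
    refine Filter.Tendsto.const_mul _ (tendsto_finsetSum _ fun j _ =>
      Filter.Tendsto.const_mul _ ?_)
    have hpos := hν (j.val + 1) (by omega)
    have h0 := (tendsto_const_nhds (x := t)).div_atTop (Filter.tendsto_id (α := ℝ))
    simpa [Real.zero_rpow hpos.ne'] using h0.rpow_const (Or.inr hpos.le)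
  simp only [mul_zero, Finset.sum_const_zero] at h
  obtain ⟨M, h1, h2⟩ := ((h.eventually (gt_mem_nhds zero_lt_one)).and
    (Filter.eventually_gt_atTop 0)).exists
  exact ⟨M, h2, h1⟩

theorem sum_Lambda_prod_pow_le (n k : ℕ) {a : Fin n → ℝ} (ha : ∀ j, 0 ≤ a j) :
    ∑ κ ∈ Lambda n k, ∏ j, a j ^ κ j ≤ (∑ j, a j) ^ k := by
  rw [Finset.sum_pow_eq_sum_piAntidiag]
  have hnn : ∀ κ : Fin n → ℕ, 0 ≤ ∏ j, a j ^ κ j := fun κ =>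
    Finset.prod_nonneg fun j _ => pow_nonneg (ha j) _
  refine (Finset.sum_le_sum fun κ _ => le_mul_of_one_le_left (hnn κ) ?_).trans
    (Finset.sum_le_sum_of_subset_of_nonneg (fun κ hκ => ?_) fun κ _ _ => ?_)
  · exact_mod_cast Nat.multinomial_pos _ _
  · rw [Lambda, Finset.mem_filter, Finset.Nat.mem_antidiagonalTuple] at hκ
    simpa using hκ.1
  · exact mul_nonneg (Nat.cast_nonneg _) (hnn κ)

theorem summable_pow_mul_birthCoeff {ν : ℕ → ℝ} (hν : ∀ m, 1 ≤ m → 0 < ν m)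
    (n : ℕ) {lam t : ℝ} (hlam : 0 ≤ lam) (ht : 0 ≤ t) :
    Summable fun k => lam ^ k * birthCoeff ν n k t := by
  obtain ⟨M, hM, hlt⟩ := exists_sum_birthRatio_lt_one hν n lam t
  have ha : ∀ j : Fin n, 0 ≤ ((j.val + 1 : ℕ) : ℝ) * (t / M) ^ ν (j.val + 1) := fun j => by
    positivity
  refine Summable.of_nonneg_of_le
    (fun k => mul_nonneg (pow_nonneg hlam _) (birthCoeff_nonneg hν n k ht)) (fun k => ?_)
    ((summable_geometric_of_lt_one
      (mul_nonneg hlam (Finset.sum_nonneg fun j _ => ha j)) hlt).mul_left (Real.exp (M + 1)))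
  calc lam ^ k * birthCoeff ν n k t
      ≤ lam ^ k * (Real.exp (M + 1) *
          (∑ j : Fin n, ((j.val + 1 : ℕ) : ℝ) * (t / M) ^ ν (j.val + 1)) ^ k) := by
        refine mul_le_mul_of_nonneg_left ?_ (pow_nonneg hlam _)
        refine (Finset.sum_le_sum fun κ _ => birthTerm_le hν κ ht hM).trans ?_
        rw [← Finset.mul_sum]
        exact mul_le_mul_of_nonneg_left (sum_Lambda_prod_pow_le n k ha) (Real.exp_nonneg _)
    _ = _ := by rw [mul_pow]; ring

theorem hasSum_neg_pow_mul_birthCoeff {ν : ℕ → ℝ} (hν : ∀ m, 1 ≤ m → 0 < ν m)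
    (n : ℕ) {lam t : ℝ} (hlam : 0 ≤ lam) (ht : 0 ≤ t) :
    HasSum (fun k => (-lam) ^ k * birthCoeff ν n k t)
      (∑' k, (-lam) ^ k * birthCoeff ν n k t) := by
  refine (Summable.of_norm_bounded (summable_pow_mul_birthCoeff hν n hlam ht) fun k => ?_).hasSum
  rw [norm_mul, norm_pow, norm_neg, Real.norm_of_nonneg hlam,
    Real.norm_of_nonneg (birthCoeff_nonneg hν n k ht)]

theorem mem_Lambda {n k : ℕ} {κ : Fin n → ℕ} :
    κ ∈ Lambda n k ↔ ∑ j, κ j = k ∧ ∀ j : Fin n, 1 ≤ j.val → 1 ≤ κ j := by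
  rw [Lambda, Finset.mem_filter, Finset.Nat.mem_antidiagonalTuple]

theorem Lambda_one (k : ℕ) : Lambda 1 k = {fun _ => k} := by
  ext κ
  rw [mem_Lambda, Finset.mem_singleton]
  constructor
  · rintro ⟨h, -⟩
    funext j
    rw [Subsingleton.elim j 0]
    simpa using h
  · rintro rfl
    exact ⟨by simp, fun j hj => by omega⟩

theorem sum_Lambda_succ {n : ℕ} (hn : 1 ≤ n) (k : ℕ) (F : (Fin (n + 1) → ℕ) → ℝ) :
    ∑ κ ∈ Lambda (n + 1) (k + 1), F κ
      = ∑ κ ∈ Lambda (n + 1) k, F (κ + Pi.single (Fin.last n) 1)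
        + ∑ κ ∈ Lambda n k, F (Fin.snoc (α := fun _ => ℕ) κ 1) := by
  rw [← Finset.sum_filter_add_sum_filter_not _ fun κ : Fin (n + 1) → ℕ => 2 ≤ κ (Fin.last n)]
  congr 1
  · symm
    refine Finset.sum_nbij' (fun κ => κ + Pi.single (Fin.last n) 1)
      (fun κ => κ - Pi.single (Fin.last n) 1) ?_ ?_ ?_ ?_ ?_
    · intro κ hκ
      rw [mem_Lambda] at hκ
      rw [Finset.mem_filter, mem_Lambda]
      refine ⟨⟨?_, fun j hj => ?_⟩, ?_⟩
      · simp [Finset.sum_add_distrib, hκ.1]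
      · exact (hκ.2 j hj).trans (by simp)
      · have := hκ.2 (Fin.last n) (by simpa)
        simp
        omega
    · intro κ hκ
      rw [Finset.mem_filter, mem_Lambda] at hκ
      rw [mem_Lambda]
      obtain ⟨⟨hs, hp⟩, hl⟩ := hκ
      rw [Fin.sum_univ_castSucc] at hs ⊢
      refine ⟨?_, fun j hj => ?_⟩
      · simp
        omega
      · have := hp j hj
        rcases eq_or_ne j (Fin.last n) with rfl | hne
        · simp
          omega
        · simpa [hne] using this
    · intro κ _
      simp
    · intro κ hκ
      rw [Finset.mem_filter] at hκ
      funext j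
      rcases eq_or_ne j (Fin.last n) with rfl | hne
      · simp
        omega
      · simp [hne]
    · intro κ _
      rfl
  · symm
    refine Finset.sum_nbij' (fun κ => Fin.snoc (α := fun _ => ℕ) κ 1) (fun κ => Fin.init κ)
      ?_ ?_ ?_ ?_ ?_
    · intro κ hκ
      rw [mem_Lambda] at hκ
      rw [Finset.mem_filter, mem_Lambda, Fin.sum_univ_castSucc]
      refine ⟨⟨?_, fun j => ?_⟩, ?_⟩
      · simp [hκ.1]
      · refine Fin.lastCases ?_ (fun i => ?_) j
        · simp
        · simpa using hκ.2 i
      · simp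
    · intro κ hκ
      rw [Finset.mem_filter, mem_Lambda, Fin.sum_univ_castSucc] at hκ
      obtain ⟨⟨hs, hp⟩, hl⟩ := hκ
      have := hp (Fin.last n) (by simpa)
      rw [mem_Lambda]
      refine ⟨?_, fun j hj => hp j.castSucc (by simpa)⟩
      simp only [Fin.init]
      omega
    · intro κ _
      simp
    · intro κ hκ
      rw [Finset.mem_filter, mem_Lambda] at hκ
      have := hκ.1.2 (Fin.last n) (by simpa)
      have h1 : κ (Fin.last n) = 1 := by omega
      simpa only [h1] using Fin.snoc_init_self κ
    · intro κ _
      rfl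

theorem rlInt_birthTerm {ν : ℕ → ℝ} (hν : ∀ m, 1 ≤ m → 0 < ν m)
    {n m : ℕ} {α : ℝ} (hα : 0 < α) (c : ℝ) (κ : Fin n → ℕ)
    (μ : Fin m → ℕ)
    (hexp : ∑ j, (μ j : ℝ) * ν (j.val + 1) = ∑ j, (κ j : ℝ) * ν (j.val + 1) + α)
    (hprod : ∏ j, ((j.val + 1 : ℕ) : ℝ) ^ (μ j) = c * ∏ j, ((j.val + 1 : ℕ) : ℝ) ^ (κ j))
    {t : ℝ} (ht : 0 ≤ t) :
    c * rlInt α (birthTerm ν κ) t = birthTerm ν μ t := by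
  have h : birthTerm ν κ = fun s => (∏ j, ((j.val + 1 : ℕ) : ℝ) ^ (κ j)) *
      (s ^ (∑ j, (κ j : ℝ) * ν (j.val + 1)) /
        Real.Gamma (1 + ∑ j, (κ j : ℝ) * ν (j.val + 1))) := by
    funext s
    rw [birthTerm]
    ring
  rw [h, rlInt_const_mul, rlInt_rpow_div_Gamma hα (birthExponent_nonneg hν κ) ht, birthTerm,
    hexp, hprod]
  ring

theorem rlInt_birthTerm_add_single {ν : ℕ → ℝ} (hν : ∀ m, 1 ≤ m → 0 < ν m)
    {n : ℕ} (κ : Fin (n + 1) → ℕ) {t : ℝ} (ht : 0 ≤ t) :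
    ((n + 1 : ℕ) : ℝ) * rlInt (ν (n + 1)) (birthTerm ν κ) t
      = birthTerm ν (κ + Pi.single (Fin.last n) 1) t := by
  refine rlInt_birthTerm hν (hν _ (by omega)) _ _ _ ?_ ?_ ht
  · simp [Fin.sum_univ_castSucc]
    ring
  · simp [Fin.prod_univ_castSucc, pow_succ]
    ring

theorem rlInt_birthTerm_snoc {ν : ℕ → ℝ} (hν : ∀ m, 1 ≤ m → 0 < ν m)
    {n : ℕ} (κ : Fin n → ℕ) {t : ℝ} (ht : 0 ≤ t) :
    ((n + 1 : ℕ) : ℝ) * rlInt (ν (n + 1)) (birthTerm ν κ) t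
      = birthTerm ν (Fin.snoc (α := fun _ => ℕ) κ 1 : Fin (n + 1) → ℕ) t := by
  refine rlInt_birthTerm hν (hν _ (by omega)) _ _ _ ?_ ?_ ht
  · simp [Fin.sum_univ_castSucc]
  · simp [Fin.prod_univ_castSucc]
    ring

theorem rlInt_birthCoeff_one {ν : ℕ → ℝ} (hν : ∀ m, 1 ≤ m → 0 < ν m) (k : ℕ) {t : ℝ} (ht : 0 ≤ t) :
    rlInt (ν 1) (birthCoeff ν 1 k) t = birthCoeff ν 1 (k + 1) t := by
  have h := rlInt_birthTerm_add_single hν (n := 0) (fun _ => k) ht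
  have hadd : (fun _ => k) + Pi.single (Fin.last 0) 1 = fun _ : Fin 1 => k + 1 := by
    funext j
    rw [Subsingleton.elim j 0]
    simp
  have hc : ∀ k, birthCoeff ν 1 k = birthTerm ν (fun _ : Fin 1 => k) := fun k => by
    funext s
    rw [birthCoeff, Lambda_one, Finset.sum_singleton]
  rw [hadd] at h
  simpa [hc] using h

theorem rlInt_birthCoeff_succ {ν : ℕ → ℝ} (hν : ∀ m, 1 ≤ m → 0 < ν m)
    {n : ℕ} (hn : 1 ≤ n) (k : ℕ) {t : ℝ} (ht : 0 ≤ t) :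
    rlInt (ν (n + 1)) (fun s => ((n + 1 : ℕ) : ℝ) *
        (birthCoeff ν (n + 1) k s + birthCoeff ν n k s)) t
      = birthCoeff ν (n + 1) (k + 1) t := by
  have hpos : 0 < ν (n + 1) := hν _ (by omega)
  have hsum : ∀ m, rlInt (ν (n + 1)) (birthCoeff ν m k) t
      = ∑ κ ∈ Lambda m k, rlInt (ν (n + 1)) (birthTerm ν κ) t := fun m =>
    rlInt_finset_sum hpos _ (fun κ _ => continuous_birthTerm hν κ) t
  rw [rlInt_const_mul, rlInt_add hpos (continuous_birthCoeff hν _ _)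
    (continuous_birthCoeff hν _ _), hsum, hsum, mul_add, Finset.mul_sum, Finset.mul_sum,
    birthCoeff, sum_Lambda_succ hn]
  simp_rw [rlInt_birthTerm_add_single hν _ ht, rlInt_birthTerm_snoc hν _ ht]

theorem birthCoeff_one_zero (ν : ℕ → ℝ) (t : ℝ) : birthCoeff ν 1 0 t = 1 := by
  simp [birthCoeff, Lambda_one, birthTerm]

theorem birthCoeff_succ_zero (ν : ℕ → ℝ) {n : ℕ} (hn : 1 ≤ n) (t : ℝ) :
    birthCoeff ν (n + 1) 0 t = 0 := by
  refine Finset.sum_eq_zero fun κ hκ => ?_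
  rw [mem_Lambda] at hκ
  have h1 := hκ.2 (Fin.last n) (by simpa)
  have h2 := Finset.sum_eq_zero_iff.1 hκ.1 (Fin.last n) (Finset.mem_univ _)
  omega

/-- If `b k` is mapped by the fractional integral to the coefficient of index `k + 1`, then the
alternating series of the coefficients solves the corresponding integral equation. -/
theorem tsum_birthCoeff_eq {ν : ℕ → ℝ} (hν : ∀ m, 1 ≤ m → 0 < ν m)
    {n : ℕ} (hn : 1 ≤ n) {lam c : ℝ} {t : ℝ}
    (hlam : 0 ≤ lam) (ht : 0 ≤ t) {b : ℕ → ℝ → ℝ} {B : ℕ → ℝ} {g : ℝ → ℝ}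
    (hb : ∀ k, Continuous (b k)) (hB : Summable fun k => lam ^ k * B k)
    (hbB : ∀ k, ∀ s ∈ Set.Icc 0 t, |b k s| ≤ B k)
    (hrec : ∀ k, rlInt (ν n) (b k) t = birthCoeff ν n (k + 1) t)
    (hg : ∀ s ∈ Set.Icc 0 t, HasSum (fun k => c * (-lam) ^ (k + 1) * b k s) (g s)) :
    c * ∑' k, (-lam) ^ k * birthCoeff ν n k t = c * birthCoeff ν n 0 t + rlInt (ν n) g t := by
  have h := rlInt_hasSum (f := fun k s => c * (-lam) ^ (k + 1) * b k s)
    (b := fun k => |c| * lam * (lam ^ k * B k)) (hν n hn) ht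
    (fun k => continuous_const.mul (hb k)) (hB.mul_left _) (fun k s hs => ?_) hg
  · simp_rw [rlInt_const_mul, hrec] at h
    have h2 := ((hasSum_neg_pow_mul_birthCoeff hν n hlam ht).mul_left c)
    rw [← hasSum_nat_add_iff' 1] at h2
    simp_rw [← mul_assoc] at h2
    have := h2.unique h
    simp at this
    linarith
  · rw [abs_mul, abs_mul, abs_pow, abs_neg, abs_of_nonneg hlam]
    calc |c| * lam ^ (k + 1) * |b k s| ≤ |c| * lam ^ (k + 1) * B k := by
          have := hbB k s hs
          gcongr
      _ = _ := by ring

/-- The SDLBP state probabilities solve the governing integral equations of SDFPBP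
with `λ_n = λ n`. -/
theorem sdlbp_integral_equation (lam : ℝ) (hlam : 0 < lam)
    (ν : ℕ → ℝ) (hν : ∀ m, 1 ≤ m → 0 < ν m ∧ ν m ≤ 1)
    (n : ℕ) (hn : 1 ≤ n) (t : ℝ) (ht : 0 ≤ t) :
    pSDLBP lam ν n t
      = (if n = 1 then (1:ℝ) else 0)
        + rlInt (ν n)
            (fun u => -(lam * (n : ℝ)) * pSDLBP lam ν n u
              + lam * ((n : ℝ) - 1) * (if n = 1 then (0:ℝ) else pSDLBP lam ν (n - 1) u)) t := by
  have hpos : ∀ m, 1 ≤ m → 0 < ν m := fun m hm => (hν m hm).1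
  rcases hn.eq_or_lt with rfl | hn'
  · have h := tsum_birthCoeff_eq hpos le_rfl (c := 1) hlam.le ht
      (g := fun u => -(lam * ((1 : ℕ) : ℝ)) * pSDLBP lam ν 1 u
        + lam * (((1 : ℕ) : ℝ) - 1) * (if 1 = 1 then (0 : ℝ) else pSDLBP lam ν (1 - 1) u))
      (continuous_birthCoeff hpos 1)
      (summable_pow_mul_birthCoeff hpos 1 hlam.le ht)
      (fun k s hs => by
        rw [abs_of_nonneg (birthCoeff_nonneg hpos 1 k hs.1)]
        exact birthCoeff_mono hpos 1 k hs.1 hs.2)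
      (fun k => rlInt_birthCoeff_one hpos k ht)
      (fun s hs => by
        have h1 := (hasSum_neg_pow_mul_birthCoeff hpos 1 hlam.le hs.1).mul_left (-lam)
        have h2 : -(lam * ((1 : ℕ) : ℝ)) * pSDLBP lam ν 1 s
            + lam * (((1 : ℕ) : ℝ) - 1) * (if 1 = 1 then (0 : ℝ) else pSDLBP lam ν (1 - 1) s)
            = -lam * ∑' k, (-lam) ^ k * birthCoeff ν 1 k s := by
          simp [pSDLBP_eq]
        rw [← h2] at h1
        exact h1.congr_fun fun k => by ring)
    rw [birthCoeff_one_zero] at h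
    simpa [pSDLBP_eq] using h
  · obtain ⟨m, rfl⟩ : ∃ m, n = m + 1 := ⟨n - 1, by omega⟩
    have hm : 1 ≤ m := by omega
    have hm0 : m ≠ 0 := by omega
    have hmR : (m : ℝ) ≠ 0 := by exact_mod_cast hm0
    have hmR' : (m : ℝ) + 1 ≠ 0 := by positivity
    have h := tsum_birthCoeff_eq hpos hn (c := (-1) ^ m / ((m + 1 : ℕ) : ℝ)) hlam.le ht
      (b := fun k s => ((m + 1 : ℕ) : ℝ) * (birthCoeff ν (m + 1) k s + birthCoeff ν m k s))
      (B := fun k => ((m + 1 : ℕ) : ℝ) * (birthCoeff ν (m + 1) k t + birthCoeff ν m k t))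
      (g := fun u => -(lam * ((m + 1 : ℕ) : ℝ)) * pSDLBP lam ν (m + 1) u
        + lam * (((m + 1 : ℕ) : ℝ) - 1) * pSDLBP lam ν m u)
      (fun k => continuous_const.mul
        ((continuous_birthCoeff hpos _ k).add (continuous_birthCoeff hpos _ k)))
      (by
        have h1 := ((summable_pow_mul_birthCoeff hpos (m + 1) hlam.le ht).add
          (summable_pow_mul_birthCoeff hpos m hlam.le ht)).mul_left ((m + 1 : ℕ) : ℝ)
        exact (summable_congr fun k => by ring).mp h1)
      (fun k s hs => by
        have h1 := birthCoeff_nonneg hpos (m + 1) k hs.1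
        have h2 := birthCoeff_nonneg hpos m k hs.1
        rw [abs_of_nonneg (by positivity)]
        have h3 := birthCoeff_mono hpos (m + 1) k hs.1 hs.2
        have h4 := birthCoeff_mono hpos m k hs.1 hs.2
        gcongr)
      (fun k => rlInt_birthCoeff_succ hpos hm k ht)
      (fun s hs => by
        have h1 := (hasSum_neg_pow_mul_birthCoeff hpos (m + 1) hlam.le hs.1).mul_left
          (-lam * (-1) ^ m)
        have h2 := (hasSum_neg_pow_mul_birthCoeff hpos m hlam.le hs.1).mul_left (-lam * (-1) ^ m)
        have hsign : (-1 : ℝ) ^ m = -(-1) ^ (m - 1) := by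
          conv_lhs => rw [← Nat.sub_add_cancel hm, pow_succ]
          ring
        have h3 : -lam * (-1) ^ m * (∑' k, (-lam) ^ k * birthCoeff ν (m + 1) k s)
            + -lam * (-1) ^ m * (∑' k, (-lam) ^ k * birthCoeff ν m k s)
            = -(lam * ((m + 1 : ℕ) : ℝ)) * pSDLBP lam ν (m + 1) s
              + lam * (((m + 1 : ℕ) : ℝ) - 1) * pSDLBP lam ν m s := by
          simp only [pSDLBP_eq, Nat.add_sub_cancel, hsign]
          push_cast
          field_simp
          ring
        rw [← h3]
        refine (h1.add h2).congr_fun fun k => ?_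
        push_cast
        field_simp
        ring)
    rw [birthCoeff_succ_zero ν hm] at h
    simpa [pSDLBP_eq, hm0] using h
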